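/- Define u : ℝ × ℝ × ℝ → ℝ by u(x₁, x₂, t) = exp(−8π²t) · sin(2πx₁) · sin(2πx₂). Then: (i) for every (x₁, x₂, t) ∈ ℝ³, the derivative of t ↦ u(x₁, x₂, t) at t equals the sum of the second derivative of y ↦ u(y, x₂, t) at x₁ and the second derivative of y ↦ u(x₁, y, t) at x₂ (i.e., ∂ₜu = Δu everywhere); (ii) u(x₁, x₂, t) = 0 for every t ∈ ℝ whenever (x₁, x₂) lies in the frontier of the open square (1/2, 1) × (1/2, 1) or in the frontier of the open square (1/2, 3/2) × (1/2, 3/2); and (iii) u is not identically zero. -/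

import Mathlib

open Real Set

theorem deriv_deriv_const_mul_sin (c a x : ℝ) :
    deriv (deriv (fun y => c * Real.sin (a * y))) x = -a ^ 2 * (c * Real.sin (a * x)) := by
  have h (y : ℝ) : HasDerivAt (fun y => a * y) a y := hasDerivAt_const_mul a
  have h₁ : deriv (fun y => c * Real.sin (a * y)) = fun y => c * (Real.cos (a * y) * a) :=
    funext fun y => ((h y).sin.const_mul c).deriv
  rw [h₁, (((h x).cos.mul_const a).const_mul c).deriv]
  ring

theorem sin_two_pi_mul_eq_zero {x : ℝ} (n : ℤ) (hx : x = n / 2) : Real.sin (2 * π * x) = 0 := by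
  rw [hx, show 2 * π * (n / 2 : ℝ) = n * π by ring, Real.sin_int_mul_pi]

theorem mem_frontier_Ioo_prod_Ioo {a b x y : ℝ} (hab : a < b)
    (h : (x, y) ∈ frontier (Ioo a b ×ˢ Ioo a b)) : (x = a ∨ x = b) ∨ y = a ∨ y = b := by
  rw [frontier_prod_eq, frontier_Ioo hab] at h
  rcases h with h | h
  · exact Or.inr h.2
  · exact Or.inl h.1

theorem heat_counterexample
    (u : ℝ → ℝ → ℝ → ℝ)
    (hu : ∀ x₁ x₂ t, u x₁ x₂ t =
      Real.exp (-8 * π ^ 2 * t) * Real.sin (2 * π * x₁) * Real.sin (2 * π * x₂)) :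
    (∀ x₁ x₂ t : ℝ,
      deriv (fun τ => u x₁ x₂ τ) t =
        deriv (deriv (fun y => u y x₂ t)) x₁ + deriv (deriv (fun y => u x₁ y t)) x₂) ∧
    (∀ x₁ x₂ : ℝ, ∀ t : ℝ,
      (x₁, x₂) ∈ frontier ((Ioo (1/2 : ℝ) 1) ×ˢ (Ioo (1/2 : ℝ) 1)) ∪
                 frontier ((Ioo (1/2 : ℝ) (3/2)) ×ˢ (Ioo (1/2 : ℝ) (3/2))) →
      u x₁ x₂ t = 0) ∧
    (∃ x₁ x₂ t : ℝ, u x₁ x₂ t ≠ 0) := by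
  have hu' : u = fun x₁ x₂ t =>
      Real.exp (-8 * π ^ 2 * t) * Real.sin (2 * π * x₁) * Real.sin (2 * π * x₂) := by
    funext x₁ x₂ t
    exact hu x₁ x₂ t
  subst hu'
  refine ⟨fun x₁ x₂ t => ?_, fun x₁ x₂ t h => ?_, 1 / 4, 1 / 4, 0, ?_⟩
  · have ht : HasDerivAt (fun τ : ℝ => -8 * π ^ 2 * τ) (-8 * π ^ 2) t :=
      hasDerivAt_const_mul _
    have hx : (fun y => Real.exp (-8 * π ^ 2 * t) * Real.sin (2 * π * y) *
          Real.sin (2 * π * x₂)) =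
        fun y => Real.exp (-8 * π ^ 2 * t) * Real.sin (2 * π * x₂) * Real.sin (2 * π * y) := by
      funext y
      ring
    rw [((ht.exp.mul_const _).mul_const _).deriv, hx, deriv_deriv_const_mul_sin,
      deriv_deriv_const_mul_sin]
    ring
  · have hs : Real.sin (2 * π * x₁) = 0 ∨ Real.sin (2 * π * x₂) = 0 := by
      rcases h with h | h
      · exact (mem_frontier_Ioo_prod_Ioo (by norm_num) h).imp
          (Or.rec (fun h => sin_two_pi_mul_eq_zero 1 (by rw [h]; norm_num))
            fun h => sin_two_pi_mul_eq_zero 2 (by rw [h]; norm_num))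
          (Or.rec (fun h => sin_two_pi_mul_eq_zero 1 (by rw [h]; norm_num))
            fun h => sin_two_pi_mul_eq_zero 2 (by rw [h]; norm_num))
      · exact (mem_frontier_Ioo_prod_Ioo (by norm_num) h).imp
          (Or.rec (fun h => sin_two_pi_mul_eq_zero 1 (by rw [h]; norm_num))
            fun h => sin_two_pi_mul_eq_zero 3 (by rw [h]; norm_num))
          (Or.rec (fun h => sin_two_pi_mul_eq_zero 1 (by rw [h]; norm_num))
            fun h => sin_two_pi_mul_eq_zero 3 (by rw [h]; norm_num))
    rcases hs with hs | hs <;> simp [hs]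
  · simp [show 2 * π * 4⁻¹ = π / 2 by ring]
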